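/- Gauge decomposition identity: let u : ℝ → ℝ be smooth, 2π-periodic, with ∫₀^{2π} u(x) dx = 0, and let F be the unique smooth 2π-periodic function with F′ = u and ∫₀^{2π} F(x) dx = 0. Then P₊(u e^{iF/2}) = −2i·(d/dx)(P₊(e^{iF/2})); equivalently, u = −2i·(∂ₓP₊e^{iF/2})·e^{−iF/2} + e^{−iF/2}·P_{≤0}(u e^{iF/2}) pointwise. -/

import Mathlib

open Real Complex MeasureTheory intervalIntegral

/-- The `k`-th Fourier coefficient `f̂(k) = (1/2π) ∫₀^{2π} f(x) e^{−ikx} dx` of a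
(`2π`-periodic) function `f : ℝ → ℂ`. -/
noncomputable def fourierCoef (f : ℝ → ℂ) (k : ℤ) : ℂ :=
  (1 / (2 * π)) * ∫ x in (0:ℝ)..(2 * π), f x * Complex.exp (-Complex.I * k * x)

/-- The Szegő projection onto positive frequencies: `P₊f = Σ_{k≥1} f̂(k) e^{ikx}`. -/
noncomputable def Pplus (f : ℝ → ℂ) (x : ℝ) : ℂ :=
  ∑' k : ℤ, if 1 ≤ k then fourierCoef f k * Complex.exp (Complex.I * k * x) else 0

/-- The projection onto negative frequencies: `P₋f = Σ_{k≤−1} f̂(k) e^{ikx}`. -/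
noncomputable def Pminus (f : ℝ → ℂ) (x : ℝ) : ℂ :=
  ∑' k : ℤ, if k ≤ -1 then fourierCoef f k * Complex.exp (Complex.I * k * x) else 0

/-- The projection onto nonpositive frequencies: `P_{≤0}f = Σ_{k≤0} f̂(k) e^{ikx}`. -/
noncomputable def Pleq0 (f : ℝ → ℂ) (x : ℝ) : ℂ :=
  ∑' k : ℤ, if k ≤ 0 then fourierCoef f k * Complex.exp (Complex.I * k * x) else 0

lemma Function.Periodic.deriv_periodic {f : ℝ → ℂ} {T : ℝ} (hf : Function.Periodic f T) :
    Function.Periodic (deriv f) T := fun x => by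
  rw [← deriv_comp_add_const, funext hf]

lemma norm_exp_I_mul_int_mul (k : ℤ) (x : ℝ) : ‖Complex.exp (Complex.I * k * x)‖ = 1 := by
  rw [show Complex.I * k * x = ((k * x : ℝ) : ℂ) * Complex.I by push_cast; ring]
  exact Complex.norm_exp_ofReal_mul_I _

lemma hasDerivAt_exp_mul_ofReal (c : ℂ) (x : ℝ) :
    HasDerivAt (fun y : ℝ => Complex.exp (c * y)) (c * Complex.exp (c * x)) x := by
  have h := (((hasDerivAt_id (x : ℂ)).const_mul c).cexp).comp_ofReal
  simpa [mul_comm] using h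

lemma fourierCoef_const_mul (c : ℂ) (f : ℝ → ℂ) (k : ℤ) :
    fourierCoef (fun x => c * f x) k = c * fourierCoef f k := by
  simp only [fourierCoef, mul_assoc c, intervalIntegral.integral_const_mul]
  ring

/-- Differentiation multiplies the `k`-th Fourier coefficient by `ik`. -/
lemma fourierCoef_deriv {f : ℝ → ℂ} (hf : ContDiff ℝ 1 f)
    (hper : Function.Periodic f (2 * π)) (k : ℤ) :
    fourierCoef (deriv f) k = Complex.I * k * fourierCoef f k := by
  have hexp : Complex.exp (-Complex.I * k * ((2 * π : ℝ) : ℂ)) = 1 := by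
    rw [Complex.exp_eq_one_iff]
    exact ⟨-k, by push_cast; ring⟩
  have hf0 : f (2 * π) = f 0 := by simpa using hper 0
  have h := intervalIntegral.integral_mul_deriv_eq_deriv_mul (a := 0) (b := 2 * π)
    (u := fun x : ℝ => Complex.exp (-Complex.I * k * x)) (v := f)
    (fun x _ => hasDerivAt_exp_mul_ofReal (-Complex.I * k) x)
    (fun x _ => (hf.differentiable one_ne_zero x).hasDerivAt)
    (Continuous.intervalIntegrable (by fun_prop) _ _)
    ((hf.continuous_deriv le_rfl).intervalIntegrable _ _)
  simp only [hexp, hf0] at h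
  simp only [mul_assoc (-Complex.I * (k : ℂ)), intervalIntegral.integral_const_mul] at h
  simp only [fourierCoef, mul_comm (deriv f _), mul_comm (f _), h]
  simp
  ring

lemma exists_norm_fourierCoef_le {f : ℝ → ℂ} (hf : Continuous f) :
    ∃ C : ℝ, ∀ k : ℤ, ‖fourierCoef f k‖ ≤ C := by
  obtain ⟨C, hC⟩ := (isCompact_uIcc (a := (0 : ℝ)) (b := 2 * π)).exists_bound_of_continuousOn
    hf.continuousOn
  refine ⟨‖(1 / (2 * π) : ℂ)‖ * (C * |2 * π - 0|), fun k => ?_⟩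
  rw [fourierCoef, norm_mul]
  gcongr
  refine intervalIntegral.norm_integral_le_of_norm_le_const fun x hx => ?_
  have h := norm_exp_I_mul_int_mul (-k) x
  rw [show Complex.I * ((-k : ℤ) : ℂ) * x = -Complex.I * k * x by push_cast; ring] at h
  rw [norm_mul, h, mul_one]
  exact hC x (Set.uIoc_subset_uIcc hx)

lemma summable_norm_fourierCoef {f : ℝ → ℂ} (hf : ContDiff ℝ 2 f)
    (hper : Function.Periodic f (2 * π)) : Summable fun k => ‖fourierCoef f k‖ := by
  have hf' : ContDiff ℝ 1 (deriv f) :=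
    ContDiff.deriv' (n := 1) (by simpa [one_add_one_eq_two] using hf)
  obtain ⟨C, hC⟩ := exists_norm_fourierCoef_le (hf'.continuous_deriv le_rfl)
  refine Summable.of_norm_bounded_eventually
    ((Real.summable_one_div_int_pow (p := 2)).2 one_lt_two |>.mul_left C) ?_
  filter_upwards [(Set.finite_singleton (0 : ℤ)).compl_mem_cofinite] with k hk
  have hk0 : (k : ℝ) ≠ 0 := by simpa using hk
  have h := hC k
  rw [fourierCoef_deriv hf' hper.deriv_periodic,
    fourierCoef_deriv (hf.of_le one_le_two) hper] at h
  simp only [norm_mul, Complex.norm_I, one_mul, Complex.norm_intCast] at h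
  rw [norm_norm, mul_one_div, le_div_iff₀ (by positivity), ← sq_abs]
  linarith

/-- Pointwise Fourier inversion for `C²` periodic functions. -/
lemma hasSum_fourierCoef_mul_exp {f : ℝ → ℂ} (hf : ContDiff ℝ 2 f)
    (hper : Function.Periodic f (2 * π)) (x : ℝ) :
    HasSum (fun k : ℤ => fourierCoef f k * Complex.exp (Complex.I * k * x)) (f x) := by
  have : Fact (0 < 2 * π) := ⟨Real.two_pi_pos⟩
  let g : C(AddCircle (2 * π), ℂ) := ⟨hper.lift, hf.continuous.quotient_lift _⟩
  have hg : ∀ y : ℝ, g y = f y := fun y => hper.lift_coe y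
  have hexp : ∀ (k : ℤ) (y : ℝ), fourier k (y : AddCircle (2 * π))
      = Complex.exp (Complex.I * k * y) := fun k y => by
    rw [fourier_coe_apply]
    congr 1
    have : (π : ℂ) ≠ 0 := by exact_mod_cast Real.pi_ne_zero
    push_cast
    field_simp
  have hcoef : fourierCoeff g = fourierCoef f := by
    ext k
    rw [fourierCoeff_eq_intervalIntegral g k 0, fourierCoef, zero_add]
    simp only [hg, hexp, smul_eq_mul, Complex.real_smul]
    push_cast
    congr 1
    refine intervalIntegral.integral_congr fun y _ => ?_
    simp only [mul_comm (f y)]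
    congr 2
    ring
  have h := has_pointwise_sum_fourier_series_of_summable (f := g)
    (by rw [hcoef]; exact (summable_norm_fourierCoef hf hper).of_norm) x
  simpa only [hcoef, hg, hexp, smul_eq_mul] using h

lemma Pplus_add_Pleq0 {f : ℝ → ℂ} (hf : ContDiff ℝ 2 f)
    (hper : Function.Periodic f (2 * π)) (x : ℝ) : Pplus f x + Pleq0 f x = f x := by
  have h := hasSum_fourierCoef_mul_exp hf hper x
  have hs (p : ℤ → Prop) [DecidablePred p] : Summable fun k : ℤ =>
      if p k then fourierCoef f k * Complex.exp (Complex.I * k * x) else 0 := by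
    refine Summable.of_norm_bounded h.summable.norm fun k => ?_
    split_ifs <;> simp
  rw [Pplus, Pleq0, ← (hs _).tsum_add (hs _), ← h.tsum_eq]
  refine tsum_congr fun k => ?_
  rcases le_or_gt 1 k with hk | hk
  · rw [if_pos hk, if_neg (by omega), add_zero]
  · rw [if_neg (by omega), if_pos (by omega), zero_add]

/-- `P₊` commutes with differentiation. -/
lemma deriv_Pplus {f : ℝ → ℂ} (hf : ContDiff ℝ 3 f)
    (hper : Function.Periodic f (2 * π)) (x : ℝ) :
    deriv (Pplus f) x = Pplus (deriv f) x := by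
  have hf' : ContDiff ℝ 2 (deriv f) :=
    ContDiff.deriv' (n := 2) (by simpa [two_add_one_eq_three] using hf)
  have hf2 : ContDiff ℝ 2 f := hf.of_le (by norm_num)
  have h := hasDerivAt_tsum (𝕜 := ℝ) (y₀ := 0)
    (g := fun (k : ℤ) (y : ℝ) =>
      if 1 ≤ k then fourierCoef f k * Complex.exp (Complex.I * k * y) else 0)
    (g' := fun (k : ℤ) (y : ℝ) =>
      if 1 ≤ k then fourierCoef (deriv f) k * Complex.exp (Complex.I * k * y) else 0)
    (summable_norm_fourierCoef hf' hper.deriv_periodic)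
    (fun k y => by
      split_ifs
      · rw [fourierCoef_deriv (hf2.of_le one_le_two) hper]
        exact ((hasDerivAt_exp_mul_ofReal (Complex.I * k) y).const_mul
          (fourierCoef f k)).congr_deriv (by ring)
      · exact hasDerivAt_const _ _)
    (fun k y => by
      split_ifs
      · rw [norm_mul, norm_exp_I_mul_int_mul, mul_one]
      · simp)
    (Summable.of_norm_bounded (summable_norm_fourierCoef hf2 hper) fun k => by
      split_ifs
      · rw [norm_mul, norm_exp_I_mul_int_mul, mul_one]
      · simp) x
  exact h.deriv

lemma Pplus_const_mul (c : ℂ) (f : ℝ → ℂ) (x : ℝ) :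
    Pplus (fun y => c * f y) x = c * Pplus f x := by
  simp only [Pplus, fourierCoef_const_mul, ← tsum_mul_left]
  refine tsum_congr fun k => ?_
  split_ifs <;> ring

/-- **Gauge decomposition identity.** For smooth `2π`-periodic zero-mean `u : ℝ → ℝ` with
zero-mean `2π`-periodic antiderivative `F`, one has
`P₊(u e^{iF/2}) = −2i ∂ₓ(P₊ e^{iF/2})`, and equivalently
`u = −2i (∂ₓP₊e^{iF/2}) e^{−iF/2} + e^{−iF/2} P_{≤0}(u e^{iF/2})` pointwise. -/
theorem gauge_decomposition (u F : ℝ → ℝ)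
    (hu : ContDiff ℝ (⊤ : ℕ∞) u) (huper : ∀ x : ℝ, u (x + 2 * π) = u x)
    (humean : ∫ x in (0:ℝ)..(2 * π), u x = 0)
    (hF : ContDiff ℝ (⊤ : ℕ∞) F) (hFper : ∀ x : ℝ, F (x + 2 * π) = F x)
    (hFderiv : ∀ x : ℝ, deriv F x = u x)
    (hFmean : ∫ x in (0:ℝ)..(2 * π), F x = 0) :
    (∀ x : ℝ,
      Pplus (fun y => (u y : ℂ) * Complex.exp (Complex.I * F y / 2)) x
        = -2 * Complex.I *
            deriv (fun y => Pplus (fun z => Complex.exp (Complex.I * F z / 2)) y) x) ∧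
    (∀ x : ℝ,
      (u x : ℂ)
        = -2 * Complex.I *
              deriv (fun y => Pplus (fun z => Complex.exp (Complex.I * F z / 2)) y) x *
              Complex.exp (-Complex.I * F x / 2)
          + Complex.exp (-Complex.I * F x / 2) *
              Pleq0 (fun z => (u z : ℂ) * Complex.exp (Complex.I * F z / 2)) x) := by
  set g : ℝ → ℂ := fun y => Complex.exp (Complex.I * F y / 2) with hg
  have hgs : ContDiff ℝ (⊤ : ℕ∞) g := by
    have : ContDiff ℝ (⊤ : ℕ∞) fun y => (F y : ℂ) := Complex.ofRealCLM.contDiff.comp hF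
    exact ((contDiff_const.mul this).div_const 2).cexp
  have hgper : Function.Periodic g (2 * π) := fun y => by simp only [hg, hFper]
  have hg' : ∀ y, deriv g y = Complex.I / 2 * (u y * g y) := fun y => by
    have h : HasDerivAt F (u y) y :=
      hFderiv y ▸ (hF.differentiable (by simp) y).hasDerivAt
    rw [(((h.ofReal_comp.const_mul Complex.I).div_const 2).cexp).deriv]
    ring
  have hug : (fun y => (u y : ℂ) * g y) = fun y => -2 * Complex.I * deriv g y := by
    ext y
    rw [hg']
    linear_combination ((u y : ℂ) * g y) * Complex.I_mul_I
  have hugs : ContDiff ℝ 2 fun y => (u y : ℂ) * g y := by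
    have : ContDiff ℝ (⊤ : ℕ∞) fun y => (u y : ℂ) := Complex.ofRealCLM.contDiff.comp hu
    exact contDiff_infty.1 (this.mul hgs) 2
  have hugper : Function.Periodic (fun y => (u y : ℂ) * g y) (2 * π) := fun y => by
    simp only [huper, hgper y]
  have hplus : ∀ x, Pplus (fun y => (u y : ℂ) * g y) x
      = -2 * Complex.I * deriv (fun y => Pplus g y) x := fun x => by
    rw [hug, Pplus_const_mul, ← deriv_Pplus (contDiff_infty.1 hgs 3) hgper]
  refine ⟨hplus, fun x => ?_⟩
  have hinv : g x * Complex.exp (-Complex.I * F x / 2) = 1 := by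
    rw [hg, ← Complex.exp_add, ← Complex.exp_zero]
    congr 1
    ring
  rw [← hplus x, mul_comm (Complex.exp _), ← add_mul, Pplus_add_Pleq0 hugs hugper, mul_assoc,
    hinv, mul_one]
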